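/- Let Σ be a symmetric positive definite real matrix indexed by V×V. Let a, c ∈ V be distinct with Σ_{ac} = 0, let B ⊆ V \ {a, c}, and let z ∈ V \ (B ∪ {a, c}). Suppose there exist x ∈ V \ (B ∪ {a, c, z}) and z' ∈ V \ (B ∪ {a, c, z, x}) such that: σ_{uw|{x}} = 0 for every u ∈ {a, c} and every w ∈ B ∪ {z}; and σ_{z'u|{z}} = 0 for every u ∈ {a, c} ∪ B. Then ρ²_{ac|B} ≤ ρ²_{ac|B∪{z'}} ≤ ρ²_{ac|B∪{z}}. -/

import Mathlib

open Matrix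

variable {V : Type*}

/-- Partial covariance `σ_{uv|Z} = Σ_{uv} − Σ_{uZ} (Σ_{ZZ})⁻¹ Σ_{Zv}`. -/
noncomputable def pcov [Fintype V] [DecidableEq V] (S : Matrix V V ℝ) (u v : V) (Z : Finset V) : ℝ :=
  S u v - ∑ i : {x // x ∈ Z}, ∑ j : {x // x ∈ Z},
    S u (i : V) * (Matrix.of (fun i j : {x // x ∈ Z} => S (i : V) (j : V)))⁻¹ i j * S (j : V) v

/-- Squared partial correlation `ρ²_{uv|Z}`. -/
noncomputable def rho2 [Fintype V] [DecidableEq V] (S : Matrix V V ℝ) (u v : V) (Z : Finset V) : ℝ :=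
  pcov S u v Z ^ 2 / (pcov S u u Z * pcov S v v Z)

/-- The partial covariance in terms of a solution `y` of the normal equations. -/
theorem pcov_eq_of_normal_equations [Fintype V] [DecidableEq V] {S : Matrix V V ℝ}
    (hpd : S.PosDef) {Z : Finset V} {u : V} (v : V) {y : V → ℝ}
    (hsupp : ∀ i, i ∉ Z → y i = 0) (hy : ∀ j ∈ Z, (y ᵥ* S) j = S u j) :
    pcov S u v Z = S u v - (y ᵥ* S) v := by
  set M : Matrix {x // x ∈ Z} {x // x ∈ Z} ℝ :=
    Matrix.of (fun i j : {x // x ∈ Z} => S (i : V) (j : V)) with hM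
  have hMpd : M.PosDef := hpd.submatrix (e := fun i : {x // x ∈ Z} => (i : V)) Subtype.val_injective
  have hdet : IsUnit M.det := hMpd.det_pos.ne'.isUnit
  have hsum : ∀ w, (y ᵥ* S) w = ∑ i : {x // x ∈ Z}, y i * S i w := fun w => by
    rw [Finset.sum_coe_sort Z (fun i => y i * S i w)]
    exact (Finset.sum_subset (Finset.subset_univ Z) fun i _ hi => by simp [hsupp i hi]).symm
  have hrow : (fun i : {x // x ∈ Z} => S u i) = (fun i : {x // x ∈ Z} => y i) ᵥ* M := by
    funext j
    rw [← hy j j.2, hsum]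
    rfl
  have hinv : (fun i : {x // x ∈ Z} => S u i) ᵥ* M⁻¹ = fun i : {x // x ∈ Z} => y i := by
    rw [hrow, Matrix.vecMul_vecMul, Matrix.mul_nonsing_inv _ hdet, Matrix.vecMul_one]
  unfold pcov
  rw [hsum, Finset.sum_comm]
  congr 1
  refine Finset.sum_congr rfl fun j _ => ?_
  rw [← Finset.sum_mul]
  exact congrArg (· * S j v) (congrFun hinv j)

/-- The normal equations on `Z` are solvable for every right-hand side. -/
theorem exists_normal_equations [Fintype V] [DecidableEq V] {S : Matrix V V ℝ}
    (hpd : S.PosDef) (Z : Finset V) (b : V → ℝ) :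
    ∃ y : V → ℝ, (∀ i, i ∉ Z → y i = 0) ∧ ∀ j ∈ Z, (y ᵥ* S) j = b j := by
  set M : Matrix {x // x ∈ Z} {x // x ∈ Z} ℝ :=
    S.submatrix (fun i => (i : V)) (fun i => (i : V)) with hM
  have hMpd : M.PosDef := hpd.submatrix Subtype.val_injective
  have hdet : IsUnit M.det := hMpd.det_pos.ne'.isUnit
  set w : {x // x ∈ Z} → ℝ := (fun i : {x // x ∈ Z} => b i) ᵥ* M⁻¹ with hw
  have hwM : w ᵥ* M = fun i : {x // x ∈ Z} => b i := by
    rw [hw, Matrix.vecMul_vecMul, Matrix.nonsing_inv_mul _ hdet, Matrix.vecMul_one]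
  refine ⟨fun i => if hi : i ∈ Z then w ⟨i, hi⟩ else 0, fun i hi => dif_neg hi, fun j hj => ?_⟩
  rw [← congrFun hwM ⟨j, hj⟩]
  have : ∀ f : V → ℝ, (∀ i, i ∉ Z → f i = 0) → ∑ i, f i = ∑ i : {x // x ∈ Z}, f i := by
    intro f hf
    rw [Finset.sum_coe_sort Z f]
    exact (Finset.sum_subset (Finset.subset_univ Z) fun i _ hi => hf i hi).symm
  refine (this _ fun i hi => by simp [hi]).trans (Finset.sum_congr rfl fun i _ => ?_)
  simp [hM]

theorem pcov_singleton [Fintype V] [DecidableEq V] {S : Matrix V V ℝ}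
    (hpd : S.PosDef) (u v x : V) : pcov S u v {x} = S u v - S u x / S x x * S x v := by
  have hx : S x x ≠ 0 := (hpd.diag_pos (i := x)).ne'
  rw [pcov_eq_of_normal_equations hpd v (y := Pi.single x (S u x / S x x))]
  · simp
  · intro i hi
    simp_all
  · intro j hj
    obtain rfl := Finset.mem_singleton.mp hj
    simp [hx]

theorem dotProduct_eq_of_support [Fintype V] {Z : Finset V} {y f g : V → ℝ}
    (hsupp : ∀ i, i ∉ Z → y i = 0) (hfg : ∀ i ∈ Z, f i = g i) : f ⬝ᵥ y = g ⬝ᵥ y :=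
  Finset.sum_congr rfl fun i _ => by
    by_cases hi : i ∈ Z
    · rw [hfg i hi]
    · simp [hsupp i hi]

theorem vecMul_dotProduct_comm [Fintype V] {S : Matrix V V ℝ} (hsym : S.IsSymm) (x y : V → ℝ) :
    (x ᵥ* S) ⬝ᵥ y = (y ᵥ* S) ⬝ᵥ x := by
  rw [← Matrix.dotProduct_mulVec, ← Matrix.vecMul_transpose, hsym.eq, dotProduct_comm]

theorem vecMul_dotProduct_self_pos [Fintype V] {S : Matrix V V ℝ} (hpd : S.PosDef)
    {y : V → ℝ} (hy : y ≠ 0) : 0 < (y ᵥ* S) ⬝ᵥ y := by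
  rw [← Matrix.dotProduct_mulVec]
  simpa using hpd.dotProduct_mulVec_pos hy

theorem vecMul_dotProduct_self_nonneg [Fintype V] {S : Matrix V V ℝ} (hpd : S.PosDef)
    (y : V → ℝ) : 0 ≤ (y ᵥ* S) ⬝ᵥ y := by
  rw [← Matrix.dotProduct_mulVec]
  simpa using hpd.posSemidef.dotProduct_mulVec_nonneg y

theorem pcov_self_pos [Fintype V] [DecidableEq V] {S : Matrix V V ℝ} (hsym : S.IsSymm)
    (hpd : S.PosDef) {u : V} {Z : Finset V} (hu : u ∉ Z) : 0 < pcov S u u Z := by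
  obtain ⟨y, hsupp, hy⟩ := exists_normal_equations hpd Z (S u)
  rw [pcov_eq_of_normal_equations hpd u hsupp hy]
  have hne : Pi.single u 1 - y ≠ 0 := fun h => by
    have := congrFun h u
    simp [hsupp u hu] at this
  have hpos := vecMul_dotProduct_self_pos hpd hne
  have h1 : (y ᵥ* S) ⬝ᵥ y = S u ⬝ᵥ y := dotProduct_eq_of_support hsupp hy
  have h2 := vecMul_dotProduct_comm hsym y (Pi.single u 1)
  have h3 : (Pi.single u (1 : ℝ)) ᵥ* S = S u := by
    funext j
    simp
  have h4 : (y ᵥ* S) ⬝ᵥ (Pi.single u 1) = (y ᵥ* S) u := by simp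
  have h5 : S u ⬝ᵥ (Pi.single u 1) = S u u := by simp
  rw [Matrix.sub_vecMul, sub_dotProduct, dotProduct_sub, dotProduct_sub, h1, h3, h4, h5] at hpos
  rw [h3, h4] at h2
  linarith

/-- If `S u w = α u * β w` on `Z`, the partial covariance depends on `Z` only through the
value `β ⬝ᵥ y` of a quadratic form. -/
theorem pcov_eq_of_factor [Fintype V] [DecidableEq V] {S : Matrix V V ℝ} (hsym : S.IsSymm)
    (hpd : S.PosDef) {Z : Finset V} {y β : V → ℝ} (hsupp : ∀ i, i ∉ Z → y i = 0)
    (hy : ∀ j ∈ Z, (y ᵥ* S) j = β j) {u v : V} {αu αv : ℝ}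
    (hu : ∀ w ∈ Z, S u w = αu * β w) (hv : ∀ w ∈ Z, S v w = αv * β w) :
    pcov S u v Z = S u v - αu * αv * (β ⬝ᵥ y) := by
  rw [pcov_eq_of_normal_equations hpd v (y := αu • y)]
  · have h1 : (y ᵥ* S) v = S v ⬝ᵥ y := by
      have := vecMul_dotProduct_comm hsym y (Pi.single v 1)
      simpa [Matrix.row] using this
    have h2 : S v ⬝ᵥ y = (αv • β) ⬝ᵥ y := dotProduct_eq_of_support hsupp hv
    rw [Matrix.smul_vecMul, Pi.smul_apply, h1, h2, smul_dotProduct]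
    simp only [smul_eq_mul]
    ring
  · intro i hi
    simp [hsupp i hi]
  · intro j hj
    simp [Matrix.smul_vecMul, hy j hj, hu j hj]

/-- Variational comparison of the values of two normal-equation systems. -/
theorem dotProduct_le_of_competitor [Fintype V] {S : Matrix V V ℝ} (hsym : S.IsSymm)
    (hpd : S.PosDef) {Z : Finset V} {β y y' : V → ℝ} {q : ℝ}
    (hsupp : ∀ i, i ∉ Z → y i = 0) (hy : ∀ j ∈ Z, (y ᵥ* S) j = β j)
    (hsupp' : ∀ i, i ∉ Z → y' i = 0) (hβ : β ⬝ᵥ y' = q) (hq : (y' ᵥ* S) ⬝ᵥ y' ≤ q) :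
    q ≤ β ⬝ᵥ y := by
  have h0 := vecMul_dotProduct_self_nonneg hpd (y - y')
  have h1 : (y ᵥ* S) ⬝ᵥ y = β ⬝ᵥ y := dotProduct_eq_of_support hsupp hy
  have h2 : (y ᵥ* S) ⬝ᵥ y' = β ⬝ᵥ y' := dotProduct_eq_of_support hsupp' hy
  have h3 := vecMul_dotProduct_comm hsym y y'
  rw [Matrix.sub_vecMul, sub_dotProduct, dotProduct_sub, dotProduct_sub, h1, h2] at h0
  linarith

theorem sq_div_mul_le_of_le {A C r s q₁ q₂ : ℝ} (h0 : 0 ≤ q₁) (h : q₁ ≤ q₂)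
    (hA : 0 < A - r * r * q₂) (hC : 0 < C - s * s * q₂) :
    (0 - r * s * q₁) ^ 2 / ((A - r * r * q₁) * (C - s * s * q₁)) ≤
      (0 - r * s * q₂) ^ 2 / ((A - r * r * q₂) * (C - s * s * q₂)) := by
  have hr : r * r * q₁ ≤ r * r * q₂ := mul_le_mul_of_nonneg_left h (mul_self_nonneg r)
  have hs : s * s * q₁ ≤ s * s * q₂ := mul_le_mul_of_nonneg_left h (mul_self_nonneg s)
  have hnum : (0 - r * s * q₁) ^ 2 ≤ (0 - r * s * q₂) ^ 2 := by
    have := mul_le_mul_of_nonneg_left (pow_le_pow_left₀ h0 h 2) (sq_nonneg (r * s))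
    linarith
  exact div_le_div₀ (sq_nonneg _) hnum (mul_pos hA hC)
    (mul_le_mul (by linarith) (by linarith) hC.le (by linarith))

theorem rho2_le_rho2_of_factor [Fintype V] [DecidableEq V] {S : Matrix V V ℝ} (hsym : S.IsSymm)
    (hpd : S.PosDef) {a c : V} (hSac : S a c = 0) {β : V → ℝ} {αa αc : ℝ}
    {Z₁ Z₂ : Finset V} (ha₂ : a ∉ Z₂) (hc₂ : c ∉ Z₂)
    (hfa₁ : ∀ w ∈ Z₁, S a w = αa * β w) (hfc₁ : ∀ w ∈ Z₁, S c w = αc * β w)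
    (hfa₂ : ∀ w ∈ Z₂, S a w = αa * β w) (hfc₂ : ∀ w ∈ Z₂, S c w = αc * β w)
    (hcomp : ∀ y : V → ℝ, (∀ i, i ∉ Z₁ → y i = 0) → ∃ y' : V → ℝ, (∀ i, i ∉ Z₂ → y' i = 0) ∧
      β ⬝ᵥ y' = β ⬝ᵥ y ∧ (y' ᵥ* S) ⬝ᵥ y' ≤ (y ᵥ* S) ⬝ᵥ y) :
    rho2 S a c Z₁ ≤ rho2 S a c Z₂ := by
  obtain ⟨y₁, hs₁, hy₁⟩ := exists_normal_equations hpd Z₁ β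
  obtain ⟨y₂, hs₂, hy₂⟩ := exists_normal_equations hpd Z₂ β
  obtain ⟨y', hs', hβ', hQ'⟩ := hcomp y₁ hs₁
  have hQ₁ : (y₁ ᵥ* S) ⬝ᵥ y₁ = β ⬝ᵥ y₁ := dotProduct_eq_of_support hs₁ hy₁
  have hle := dotProduct_le_of_competitor hsym hpd hs₂ hy₂ hs' hβ' (hQ₁ ▸ hQ')
  have h0 : 0 ≤ β ⬝ᵥ y₁ := hQ₁ ▸ vecMul_dotProduct_self_nonneg hpd y₁
  have hA := pcov_self_pos hsym hpd ha₂
  have hC := pcov_self_pos hsym hpd hc₂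
  rw [pcov_eq_of_factor hsym hpd hs₂ hy₂ hfa₂ hfa₂] at hA
  rw [pcov_eq_of_factor hsym hpd hs₂ hy₂ hfc₂ hfc₂] at hC
  unfold rho2
  rw [pcov_eq_of_factor hsym hpd hs₁ hy₁ hfa₁ hfc₁, pcov_eq_of_factor hsym hpd hs₁ hy₁ hfa₁ hfa₁,
    pcov_eq_of_factor hsym hpd hs₁ hy₁ hfc₁ hfc₁, pcov_eq_of_factor hsym hpd hs₂ hy₂ hfa₂ hfc₂,
    pcov_eq_of_factor hsym hpd hs₂ hy₂ hfa₂ hfa₂, pcov_eq_of_factor hsym hpd hs₂ hy₂ hfc₂ hfc₂,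
    hSac]
  exact sq_div_mul_le_of_le h0 hle hA hC

/-- Theorem 3: if `a ⟂⟂ c`, `{a,c} ⟂⟂ {z} ∪ B | x` and
`z' ⟂⟂ {a,c} ∪ B | z`, then `ρ²_{ac|B} ≤ ρ²_{ac|B∪{z'}} ≤ ρ²_{ac|B∪{z}}`. -/
theorem stmt_4 [Fintype V] [DecidableEq V] [Nonempty V]
    (S : Matrix V V ℝ) (hsym : S.IsSymm) (hpd : S.PosDef)
    (a c : V) (hac : a ≠ c) (hSac : S a c = 0)
    (B : Finset V) (haB : a ∉ B) (hcB : c ∉ B)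
    (z : V) (hzB : z ∉ B) (hza : z ≠ a) (hzc : z ≠ c)
    (z' : V) (hz'B : z' ∉ B) (hz'a : z' ≠ a) (hz'c : z' ≠ c) (hz'z : z' ≠ z)
    (h : ∃ x : V, x ∉ B ∧ x ≠ a ∧ x ≠ c ∧ x ≠ z ∧ x ≠ z' ∧
      ∀ u ∈ ({a, c} : Finset V), ∀ w ∈ insert z B, pcov S u w {x} = 0)
    (h' : ∀ u ∈ insert a (insert c B), pcov S z' u {z} = 0) :
    rho2 S a c B ≤ rho2 S a c (insert z' B) ∧
      rho2 S a c (insert z' B) ≤ rho2 S a c (insert z B) := by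
  obtain ⟨x, -, -, -, -, -, hx⟩ := h
  set k : ℝ := S z' z / S z z with hk
  have hzz : S z z ≠ 0 := (hpd.diag_pos (i := z)).ne'
  have hproxy : ∀ u ∈ insert a (insert c B), S z' u = k * S z u := fun u hu => by
    have := h' u hu
    rw [pcov_singleton hpd] at this
    linarith
  set β : V → ℝ := Function.update (S x) z' (k * S x z) with hβ
  have hβz' : β z' = k * S x z := Function.update_self ..
  have hβne : ∀ w, w ≠ z' → β w = S x w := fun w hw => Function.update_of_ne hw ..
  have hfac : ∀ u ∈ ({a, c} : Finset V), ∀ w ∈ insert z' (insert z B),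
      S u w = S u x / S x x * β w := by
    intro u hu w hw
    have hold : ∀ w ∈ insert z B, S u w = S u x / S x x * S x w := fun w hw => by
      have := hx u hu w hw
      rw [pcov_singleton hpd] at this
      linarith
    rcases Finset.mem_insert.mp hw with rfl | hw
    · have hu' : u ∈ insert a (insert c B) := by
        simp only [Finset.mem_insert, Finset.mem_singleton] at hu ⊢
        tauto
      rw [hβz', ← hsym.apply, hproxy u hu', hsym.apply, hold z (Finset.mem_insert_self z B)]
      ring
    · have hne : w ≠ z' := by
        rintro rfl
        simp_all
      rw [hβne w hne, hold w hw]
  have hfa := hfac a (by simp)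
  have hfc := hfac c (by simp)
  have hsub₀ : B ⊆ insert z' (insert z B) := fun w hw => by simp [hw]
  have hsub₁ : insert z' B ⊆ insert z' (insert z B) :=
    Finset.insert_subset_insert _ (Finset.subset_insert z B)
  have hsub₂ : insert z B ⊆ insert z' (insert z B) := Finset.subset_insert _ _
  constructor
  · refine rho2_le_rho2_of_factor hsym hpd hSac (by simp [haB, hz'a.symm])
      (by simp [hcB, hz'c.symm]) (fun w hw => hfa w (hsub₀ hw)) (fun w hw => hfc w (hsub₀ hw))
      (fun w hw => hfa w (hsub₁ hw)) (fun w hw => hfc w (hsub₁ hw)) fun y hy =>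
      ⟨y, fun i hi => hy i fun hiB => hi (Finset.mem_insert_of_mem hiB), rfl, le_rfl⟩
  · refine rho2_le_rho2_of_factor hsym hpd hSac (by simp [haB, hza.symm])
      (by simp [hcB, hzc.symm]) (fun w hw => hfa w (hsub₁ hw)) (fun w hw => hfc w (hsub₁ hw))
      (fun w hw => hfa w (hsub₂ hw)) (fun w hw => hfc w (hsub₂ hw)) fun y hy => ?_
    set d : V → ℝ := Pi.single z k - Pi.single z' 1 with hd
    have hdS : ∀ j, (d ᵥ* S) j = k * S z j - S z' j := fun j => by
      simp [hd, Matrix.sub_vecMul]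
    have hdz : (d ᵥ* S) z = 0 := by
      rw [hdS, hk]
      field_simp
      ring
    have hdd : (d ᵥ* S) ⬝ᵥ d = -(d ᵥ* S) z' := by
      rw [hd, dotProduct_sub, dotProduct_single, dotProduct_single, ← hd, hdz]
      ring
    have hdy : (d ᵥ* S) ⬝ᵥ y = (d ᵥ* S) z' * y z' := by
      have : ∀ j ∈ insert z' B, (d ᵥ* S) j = (Pi.single z' ((d ᵥ* S) z') : V → ℝ) j := by
        intro j hj
        rcases Finset.mem_insert.mp hj with rfl | hj
        · simp
        · have hne : j ≠ z' := ne_of_mem_of_not_mem hj hz'B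
          rw [Pi.single_eq_of_ne hne, hdS, hproxy j (by simp [hj]), sub_self]
      rw [dotProduct_eq_of_support hy this, single_dotProduct]
    have hyd := vecMul_dotProduct_comm hsym y d
    have hnn := vecMul_dotProduct_self_nonneg hpd d
    refine ⟨y + y z' • d, fun i hi => ?_, ?_, ?_⟩
    · simp only [Finset.mem_insert, not_or] at hi
      rcases eq_or_ne i z' with rfl | hne
      · simp [hd, hz'z]
      · have := hy i (by simp [hne, hi.2])
        simp [hd, hne, hi.1, this]
    · have hβd : β ⬝ᵥ d = 0 := by
        rw [hd, dotProduct_sub, dotProduct_single, dotProduct_single, hβz', hβne z hz'z.symm]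
        ring
      rw [dotProduct_add, dotProduct_smul, hβd, smul_zero, add_zero]
    · rw [Matrix.add_vecMul, Matrix.smul_vecMul, add_dotProduct, dotProduct_add, dotProduct_add,
        smul_dotProduct, smul_dotProduct, dotProduct_smul, dotProduct_smul, hyd, hdy]
      rw [hdd] at hnn ⊢
      simp only [smul_eq_mul]
      nlinarith [mul_nonneg hnn (mul_self_nonneg (y z'))]
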